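/- arXiv:1501.04289 — 2 statements merged into one kernel-verified Lean document; each statement's English description precedes it below -/
import Mathlib

section
/- Let ε ∈ (0, σ₀/4) and assume x, x₁, x₂ ∈ X are such that x_i ∈ 𝒫_{ε/5}(x) with x_i = (u_i,s_i)_x for i = 1,2. Then for any T > 0: (a) if |u₁ − u₂| < (ε/2) e^{−T}, then d_X(φ_t(x₁),φ_t(x₂)) < ε for all t ∈ [0,T]; (b) if |s₁ − s₂ − s₁s₂(u₁ − u₂)| < (ε/2) e^{−T}, then d_X(φ_t(x₁),φ_t(x₂)) < ε for all t ∈ [−T,0]; (c) if |u₁ − u₂| + |s₁ − s₂| < (ε/2) e^{−T}, then d_X(φ_t(x₁),φ_t(x₂)) < ε for all t ∈ [−T,T]. -/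
noncomputable section

open Real

abbrev SL2 : Type := Matrix.SpecialLinearGroup (Fin 2) ℝ
abbrev PSL2 : Type := SL2 ⧸ Subgroup.center SL2

def projSL : SL2 →* PSL2 := QuotientGroup.mk' (Subgroup.center SL2)

def Amat (t : ℝ) : SL2 :=
  ⟨!![Real.exp (t / 2), 0; 0, Real.exp (-(t / 2))], by
    simp [Matrix.det_fin_two_of, ← Real.exp_add]⟩

def Bmat (t : ℝ) : SL2 :=
  ⟨!![1, t; 0, 1], by simp [Matrix.det_fin_two_of]⟩

def Cmat (t : ℝ) : SL2 :=
  ⟨!![1, 0; t, 1], by simp [Matrix.det_fin_two_of]⟩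

def Dmat : SL2 :=
  ⟨!![0, 1; -1, 0], by norm_num [Matrix.det_fin_two_of]⟩

def aflow (t : ℝ) : PSL2 := projSL (Amat t)
def bhor (t : ℝ) : PSL2 := projSL (Bmat t)
def chor (t : ℝ) : PSL2 := projSL (Cmat t)
def dpi : PSL2 := projSL Dmat

abbrev Xq (Γ : Subgroup PSL2) : Type := Quotient (QuotientGroup.rightRel Γ)

def xmk (Γ : Subgroup PSL2) (g : PSL2) : Xq Γ :=
  Quotient.mk (QuotientGroup.rightRel Γ) g

def flow (Γ : Subgroup PSL2) (t : ℝ) : Xq Γ → Xq Γ :=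
  Quotient.lift (fun g => xmk Γ (g * aflow t)) (fun g h hgh => Quot.sound (by
    have h1 : h * g⁻¹ ∈ Γ := QuotientGroup.rightRel_apply.mp hgh
    refine QuotientGroup.rightRel_apply.mpr ?_
    have heq : h * aflow t * (g * aflow t)⁻¹ = h * g⁻¹ := by group
    rw [heq]; exact h1))

def trev (Γ : Subgroup PSL2) : Xq Γ → Xq Γ :=
  Quotient.lift (fun g => xmk Γ (g * dpi)) (fun g h hgh => Quot.sound (by
    have h1 : h * g⁻¹ ∈ Γ := QuotientGroup.rightRel_apply.mp hgh
    refine QuotientGroup.rightRel_apply.mpr ?_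
    have heq : h * dpi * (g * dpi)⁻¹ = h * g⁻¹ := by group
    rw [heq]; exact h1))

def dX (Γ : Subgroup PSL2) (dG : PSL2 → PSL2 → ℝ) (x y : Xq Γ) : ℝ :=
  sInf {r : ℝ | ∃ g h : PSL2, xmk Γ g = x ∧ xmk Γ h = y ∧ dG g h = r}

def Psec (Γ : Subgroup PSL2) (ε : ℝ) (x : Xq Γ) : Set (Xq Γ) :=
  {y | ∃ (g : PSL2) (u s : ℝ), xmk Γ g = x ∧ |u| < ε ∧ |s| < ε ∧
        y = xmk Γ (g * chor u * bhor s)}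

def Psec' (Γ : Subgroup PSL2) (ε : ℝ) (x : Xq Γ) : Set (Xq Γ) :=
  {y | ∃ (g : PSL2) (s u : ℝ), xmk Γ g = x ∧ |s| < ε ∧ |u| < ε ∧
        y = xmk Γ (g * bhor s * chor u)}

def Wsloc (Γ : Subgroup PSL2) (ε : ℝ) (x : Xq Γ) : Set (Xq Γ) :=
  {y | ∃ (g : PSL2) (t : ℝ), xmk Γ g = x ∧ |t| < ε ∧ y = xmk Γ (g * bhor t)}

def Wuloc (Γ : Subgroup PSL2) (ε : ℝ) (x : Xq Γ) : Set (Xq Γ) :=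
  {y | ∃ (g : PSL2) (t : ℝ), xmk Γ g = x ∧ |t| < ε ∧ y = xmk Γ (g * chor t)}

instance : TopologicalSpace SL2 :=
  TopologicalSpace.induced (fun A : SL2 => (A : Matrix (Fin 2) (Fin 2) ℝ)) inferInstance

/-- The properties of the length function `M ↦ d(M, 1)` of a left-invariant metric on `PSL(2, ℝ)`,
read on `SL(2, ℝ)`, that are used to estimate distances. -/
structure IsLength (N : SL2 → ℝ) : Prop where
  mul (X Y : SL2) : N (X * Y) ≤ N X + N Y
  neg (X : SL2) : N (-X) = N X
  inv (X : SL2) : N X⁻¹ = N X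
  stable (s : ℝ) : N (Bmat s) ≤ |s|
  unstable (u : ℝ) : N (Cmat u) ≤ |u|
  diag (τ : ℝ) : N (Amat τ) ≤ |τ| / √2

lemma SL2.det_eq (M : SL2) : M 0 0 * M 1 1 - M 0 1 * M 1 0 = 1 := by
  have h := M.det_coe
  rwa [Matrix.det_fin_two] at h

lemma SL2.mul_apply (X Y : SL2) (i j : Fin 2) :
    (X * Y : SL2) i j = X i 0 * Y 0 j + X i 1 * Y 1 j := by
  rw [Matrix.SpecialLinearGroup.coe_mul, Matrix.mul_apply, Fin.sum_univ_two]

lemma SL2.ext_entries {X Y : SL2} (h₀₀ : X 0 0 = Y 0 0) (h₀₁ : X 0 1 = Y 0 1)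
    (h₁₀ : X 1 0 = Y 1 0) (h₁₁ : X 1 1 = Y 1 1) : X = Y := by
  ext i j
  fin_cases i <;> fin_cases j <;> assumption

lemma projSL_neg (M : SL2) : projSL (-M) = projSL M := by
  refine (QuotientGroup.eq.mpr ?_).symm
  rw [mul_neg, inv_mul_cancel, Subgroup.mem_center_iff]
  intro g
  simp

lemma SL2.inv_entries (M : SL2) : (M⁻¹ : SL2) 0 0 = M 1 1 ∧ (M⁻¹ : SL2) 0 1 = -M 0 1 ∧
    (M⁻¹ : SL2) 1 0 = -M 1 0 ∧ (M⁻¹ : SL2) 1 1 = M 0 0 := by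
  rw [Matrix.SpecialLinearGroup.SL2_inv_expl]
  simp

/-- The relative position at time `-log r` of two points on a Poincaré section whose unstable
coordinates differ by `w` and whose stable coordinates are `s₁` and `s₂`. -/
def relPos (r w s₁ s₂ : ℝ) : SL2 := Bmat (-s₂ * r) * Cmat (w / r) * Bmat (s₁ * r)

lemma relPos_entries {r : ℝ} (hr : r ≠ 0) (w s₁ s₂ : ℝ) :
    relPos r w s₁ s₂ 0 0 = 1 - s₂ * w ∧ relPos r w s₁ s₂ 0 1 = r * (s₁ - s₂ - s₁ * s₂ * w) ∧
      relPos r w s₁ s₂ 1 0 = w / r ∧ relPos r w s₁ s₂ 1 1 = 1 + s₁ * w := by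
  refine ⟨?_, ?_, ?_, ?_⟩ <;> simp only [relPos, SL2.mul_apply] <;> simp [Bmat, Cmat] <;>
    field_simp <;> ring

/-- The elementary inequality behind the case of opposite stable coordinates. -/
lemma add_mul_add_div_lt {ε r a b v : ℝ} (hε : 0 < ε) (hε2 : ε ^ 2 ≤ 93 / 10) (hr : 1 ≤ r)
    (ha : 0 ≤ a) (hb : 0 ≤ b) (ha' : a < ε / 5) (hb' : b < ε / 5) (hv : 0 ≤ v)
    (hv' : v < 2 / 5 * ε) (hp : r * (a + b - a * b * v) < ε / 2) :
    (a + b) * r + v / r < ε := by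
  have hr0 : 0 < r := by linarith
  have hc0 : 0 ≤ a + b := by linarith
  have hcv : (a + b) * v ≤ 4 / 25 * ε ^ 2 := by
    nlinarith [mul_le_mul (show a + b ≤ 2 / 5 * ε by linarith) hv'.le hv (by positivity)]
  have hab : a * b * v ≤ 93 / 250 * (a + b) := by
    have h1 : a * b ≤ (a + b) ^ 2 / 4 := by nlinarith [sq_nonneg (a - b)]
    have h2 := mul_le_mul_of_nonneg_right h1 hv
    have h3 := mul_le_mul_of_nonneg_left hcv hc0
    nlinarith
  have hy : (a + b) * r < 4 / 5 * ε := by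
    have := mul_le_mul_of_nonneg_left hab hr0.le
    nlinarith
  rw [add_div' _ _ _ hr0.ne', div_lt_iff₀ hr0]
  rcases lt_or_ge ((a + b) * r) (1 / 5 * ε) with h | h
  · nlinarith [mul_lt_mul_of_pos_right h hr0]
  · have hc : 0 < a + b := by
      by_contra hc
      nlinarith
    refine lt_of_mul_lt_mul_left ?_ hc.le
    have hcv' : (a + b) * v < 4 / 25 * ε ^ 2 := by nlinarith
    nlinarith [mul_nonneg (sub_nonneg.mpr h) (sub_nonneg.mpr hy.le)]

lemma abs_mul_le_of_lt {ε s w : ℝ} (hs : |s| < ε / 5) (hw : |w| < 2 / 5 * ε) :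
    |s * w| ≤ 2 / 25 * ε ^ 2 := by
  rw [abs_mul]
  nlinarith [mul_le_mul hs.le hw.le (abs_nonneg w) (by linarith [abs_nonneg s])]

namespace IsLength

variable {N : SL2 → ℝ}

lemma mul₃ (h : IsLength N) (X Y Z : SL2) : N (X * Y * Z) ≤ N X + N Y + N Z :=
  (h.mul _ _).trans (by linarith [h.mul X Y])

/-- Bound from the factorization of a matrix with nonzero lower left entry as `b c b`. -/
lemma le_of_lower_ne_zero (h : IsLength N) (M : SL2) (hγ : M 1 0 ≠ 0) :
    N M ≤ (|1 - M 0 0| + |1 - M 1 1|) / |M 1 0| + |M 1 0| := by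
  have hM : M = Bmat ((M 0 0 - 1) / M 1 0) * Cmat (M 1 0) * Bmat ((M 1 1 - 1) / M 1 0) := by
    have hd := M.det_eq
    refine SL2.ext_entries ?_ ?_ ?_ ?_ <;> simp only [SL2.mul_apply] <;>
      simp [Bmat, Cmat] <;> field_simp <;> linarith
  have h1 := h.mul₃ (Bmat ((M 0 0 - 1) / M 1 0)) (Cmat (M 1 0)) (Bmat ((M 1 1 - 1) / M 1 0))
  rw [← hM] at h1
  have h2 := h.stable ((M 0 0 - 1) / M 1 0)
  have h3 := h.stable ((M 1 1 - 1) / M 1 0)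
  rw [abs_div, abs_sub_comm] at h2 h3
  rw [add_div]
  linarith [h.unstable (M 1 0)]

/-- Bound from the factorization of a matrix with nonzero upper right entry as `c b c`. -/
lemma le_of_upper_ne_zero (h : IsLength N) (M : SL2) (hβ : M 0 1 ≠ 0) :
    N M ≤ (|1 - M 0 0| + |1 - M 1 1|) / |M 0 1| + N (Bmat (M 0 1)) := by
  have hM : M = Cmat ((M 1 1 - 1) / M 0 1) * Bmat (M 0 1) * Cmat ((M 0 0 - 1) / M 0 1) := by
    have hd := M.det_eq
    refine SL2.ext_entries ?_ ?_ ?_ ?_ <;> simp only [SL2.mul_apply] <;>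
      simp [Bmat, Cmat] <;> field_simp <;> linarith
  have h1 := h.mul₃ (Cmat ((M 1 1 - 1) / M 0 1)) (Bmat (M 0 1)) (Cmat ((M 0 0 - 1) / M 0 1))
  rw [← hM] at h1
  have h2 := h.unstable ((M 0 0 - 1) / M 0 1)
  have h3 := h.unstable ((M 1 1 - 1) / M 0 1)
  rw [abs_div, abs_sub_comm] at h2 h3
  rw [add_div]
  linarith

lemma upper_neg (h : IsLength N) (s : ℝ) : N (Bmat (-s)) = N (Bmat s) := by
  rw [← h.inv (Bmat s)]
  congr 1
  refine eq_inv_of_mul_eq_one_left ?_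
  refine SL2.ext_entries ?_ ?_ ?_ ?_ <;> simp only [SL2.mul_apply] <;> simp [Bmat]

/-- For `|α|, |δ| ≤ 1`, one of `M`, `-M` has nonnegative trace; this normalizes the numerators of
the two preceding bounds. -/
lemma exists_defect (h : IsLength N) (M : SL2) (hα : |M 0 0| ≤ 1) (hδ : |M 1 1| ≤ 1) :
    ∃ D, 0 ≤ D ∧ D ≤ 2 ∧ (|M 0 1 * M 1 0| < 1 → D ≤ 2 * |M 0 1 * M 1 0|) ∧
      (M 1 0 ≠ 0 → N M ≤ D / |M 1 0| + |M 1 0|) ∧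
      (M 0 1 ≠ 0 → N M ≤ D / |M 0 1| + N (Bmat (M 0 1))) := by
  wlog hs : 0 ≤ M 0 0 + M 1 1 generalizing M
  · have := this (-M) (by simpa using hα) (by simpa using hδ)
      (by simp; linarith)
    simpa [h.neg, h.upper_neg] using this
  have hd := M.det_eq
  rw [abs_le] at hα hδ
  have e1 : |1 - M 0 0| = 1 - M 0 0 := abs_of_nonneg (by linarith)
  have e2 : |1 - M 1 1| = 1 - M 1 1 := abs_of_nonneg (by linarith)
  refine ⟨|1 - M 0 0| + |1 - M 1 1|, by positivity, by rw [e1, e2]; linarith, fun hlt => ?_,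
    h.le_of_lower_ne_zero M, h.le_of_upper_ne_zero M⟩
  have hpos : 0 < M 0 0 * M 1 1 := by linarith [(abs_lt.mp hlt).1]
  have hα0 : 0 < M 0 0 := by
    by_contra hc
    have : M 1 1 < 0 := by
      by_contra hc'
      nlinarith
    linarith
  have hδ0 : 0 < M 1 1 := by
    by_contra hc
    nlinarith
  rw [e1, e2]
  have : 1 - M 0 0 * M 1 1 ≤ |M 0 1 * M 1 0| := by
    linarith [neg_le_abs (M 0 1 * M 1 0)]
  nlinarith [mul_nonneg hα0.le (sub_nonneg.mpr hδ.2), mul_nonneg hδ0.le (sub_nonneg.mpr hα.2)]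

/-- Bound from the factorization of a matrix with nonzero upper left entry as `c a b`. -/
lemma le_of_diag_ne_zero (h : IsLength N) (M : SL2) (hα : M 0 0 ≠ 0) :
    N M ≤ |M 1 0| / |M 0 0| + √2 * |Real.log (M 0 0)| + N (Bmat (M 0 1 / M 0 0)) := by
  wlog hs : 0 < M 0 0 generalizing M
  · have := this (-M) (by simpa using hα)
      (by simpa using lt_of_le_of_ne (not_lt.mp hs) hα)
    simpa [h.neg] using this
  have hM : M = Cmat (M 1 0 / M 0 0) * Amat (2 * Real.log (M 0 0)) * Bmat (M 0 1 / M 0 0) := by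
    have hd := M.det_eq
    refine SL2.ext_entries ?_ ?_ ?_ ?_ <;> simp only [SL2.mul_apply] <;>
      simp [Amat, Bmat, Cmat, Real.exp_neg, Real.exp_log hs]
    · field_simp
    · field_simp
    · field_simp
      linarith
  have h1 := h.mul₃ (Cmat (M 1 0 / M 0 0)) (Amat (2 * Real.log (M 0 0))) (Bmat (M 0 1 / M 0 0))
  rw [← hM] at h1
  have h2 := h.unstable (M 1 0 / M 0 0)
  have h3 := h.diag (2 * Real.log (M 0 0))
  have h4 : |2 * Real.log (M 0 0)| / √2 = √2 * |Real.log (M 0 0)| := by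
    rw [abs_mul, abs_two, div_eq_iff (by positivity)]
    linear_combination -|Real.log (M 0 0)| * Real.mul_self_sqrt (zero_le_two (α := ℝ))
  rw [abs_div] at h2
  rw [h4] at h3
  rw [abs_of_pos hs] at h2 ⊢
  linarith

/-- Long unipotents have logarithmic length. -/
lemma upper_le_log (h : IsLength N) {s b : ℝ} (hs : |s| ≤ √2 * b) (hb : 1 ≤ b) :
    N (Bmat s) ≤ √2 * (1 + Real.log b) := by
  have hb0 : 0 < b := by linarith
  have hL := Real.log_nonneg hb
  have hM : Bmat s = Amat (Real.log b) * Bmat (s / b) * (Amat (Real.log b))⁻¹ := by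
    rw [eq_mul_inv_iff_mul_eq]
    have he : Real.exp (Real.log b / 2) * Real.exp (Real.log b / 2) = b := by
      rw [← Real.exp_add, add_halves, Real.exp_log hb0]
    have hp := Real.exp_pos (Real.log b / 2)
    refine SL2.ext_entries ?_ ?_ ?_ ?_ <;> simp only [SL2.mul_apply] <;>
      simp [Amat, Bmat, Real.exp_neg]
    field_simp
    linear_combination -s * he
  have h1 := h.mul₃ (Amat (Real.log b)) (Bmat (s / b)) (Amat (Real.log b))⁻¹
  rw [← hM, h.inv] at h1
  have h2 := h.diag (Real.log b)
  have h3 := h.stable (s / b)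
  have h4 : |s / b| ≤ √2 := by
    rw [abs_div, abs_of_pos hb0, div_le_iff₀ hb0]
    exact hs
  have h5 : |Real.log b| / √2 * 2 = √2 * Real.log b := by
    rw [abs_of_nonneg hL, div_mul_eq_mul_div, div_eq_iff (by positivity)]
    linear_combination -Real.log b * Real.mul_self_sqrt (zero_le_two (α := ℝ))
  linarith

/-- A matrix with diagonal entries in `[-1, 1]` has small length compared to `ε`, provided its
off-diagonal entries are not too large. -/
lemma lt_of_diag_le_one (h : IsLength N) (M : SL2) {ε : ℝ} (hε : 93 / 10 < ε ^ 2) (hε0 : 0 < ε)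
    (hα : |M 0 0| ≤ 1) (hδ : |M 1 1| ≤ 1) (hγ : |M 1 0| < ε / 2)
    (hβ : |M 0 1| < ε / 2 ∨ 5 ≤ ε ∧ N (Bmat (M 0 1)) < 3 / 5 * ε) : N M < ε := by
  obtain ⟨D, hD0, hD2, hD, hc, hb⟩ := h.exists_defect M hα hδ
  have hε3 : 3 < ε := by nlinarith
  have key : ∀ q : ℝ, 1 ≤ q → q < ε / 2 → D / q + q < ε := by
    intro q hq hq'
    have : D / q + q = (D + q * q) / q := by field_simp
    rw [this, div_lt_iff₀ (by linarith)]
    nlinarith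
  rcases le_or_gt 1 |M 1 0| with h1 | h1
  · exact (hc (abs_pos.mp (by linarith))).trans_lt (key _ h1 hγ)
  rcases le_or_gt 1 |M 0 1| with h2 | h2
  · have hle := hb (abs_pos.mp (by linarith))
    rcases hβ with hβ | ⟨hε5, hβ⟩
    · linarith [key _ h2 hβ, h.stable (M 0 1)]
    · have : D / |M 0 1| ≤ D := div_le_self hD0 h2
      linarith
  have hprod : |M 0 1 * M 1 0| < 1 := by
    rw [abs_mul]
    nlinarith [abs_nonneg (M 0 1), abs_nonneg (M 1 0)]
  have hD' := hD hprod
  rw [abs_mul] at hD'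
  rcases eq_or_ne (M 1 0) 0 with h0 | h0
  · rcases eq_or_ne (M 0 1) 0 with h0' | h0'
    · have hl := h.le_of_diag_ne_zero M (fun h00 => by have := M.det_eq; simp [h0, h00] at this)
      have h00 : |M 0 0| = 1 := by
        have hd := M.det_eq
        rw [h0, mul_zero, sub_zero] at hd
        have : |M 0 0| * |M 1 1| = 1 := by rw [← abs_mul, hd, abs_one]
        nlinarith [abs_nonneg (M 0 0), abs_nonneg (M 1 1)]
      have := h.stable (M 0 1 / M 0 0)
      rw [← Real.log_abs] at hl
      simp [h00, h0, h0'] at hl this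
      linarith
    · have : D / |M 0 1| ≤ 0 := by
        rw [div_le_iff₀ (abs_pos.mpr h0')]
        simpa [h0] using hD'
      linarith [hb h0', h.stable (M 0 1)]
  · have : D / |M 1 0| ≤ 2 * |M 0 1| := by
      rw [div_le_iff₀ (abs_pos.mpr h0)]
      linarith
    linarith [hc h0]

lemma upper_lt (h : IsLength N) {s ε : ℝ} (hε : 5 ≤ ε) (hs : |s| ≤ ε ^ 3 / 50) :
    √2 * (1 + Real.log (ε ^ 3 / (50 * √2))) < 3 / 5 * ε ∧ N (Bmat s) < 3 / 5 * ε := by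
  have hq : √2 * √2 = 2 := Real.mul_self_sqrt zero_le_two
  have hq0 : 0 < √2 := by positivity
  have hq1 : √2 < 3 / 2 := by nlinarith
  have hε3 : 125 ≤ ε ^ 3 := by
    have := pow_le_pow_left₀ (by norm_num) hε 3
    linarith
  have hb : 1 ≤ ε ^ 3 / (50 * √2) := by
    rw [le_div_iff₀ (by positivity)]
    linarith
  have hlog5 : Real.log 5 < 2 := by
    linarith [Real.log_five_lt_d9]
  have hx : 0 < ε / (5 * √2) := by positivity
  have hlog : Real.log (ε ^ 3 / (50 * √2)) = Real.log 5 + 3 * Real.log (ε / (5 * √2)) := by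
    have : ε ^ 3 / (50 * √2) = 5 * (ε / (5 * √2)) ^ 3 := by
      field_simp
      linear_combination 25 * hq
    rw [this, Real.log_mul (by norm_num) (by positivity), Real.log_pow]
    norm_num
  have hlt : √2 * (1 + Real.log (ε ^ 3 / (50 * √2))) < 3 / 5 * ε := by
    have h1 := Real.log_le_sub_one_of_pos hx
    have h2 : √2 * (ε / (5 * √2)) = ε / 5 := by field_simp
    rw [hlog]
    nlinarith
  refine ⟨hlt, (h.upper_le_log ?_ hb).trans_lt hlt⟩
  convert hs using 1
  field_simp

/-- A matrix close to being diagonal, with upper left entry at least `1`, is short. -/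
lemma lt_of_one_le (h : IsLength N) (M : SL2) {ε : ℝ} (hε : 0 < ε) (hα : 1 ≤ |M 0 0|)
    (hα' : |M 0 0| ≤ 1 + 2 / 25 * ε ^ 2) (hoff : |M 0 1| + |M 1 0| < 9 / 10 * ε) : N M < ε := by
  have hm0 : 0 < |M 0 0| := by linarith
  have h1 := h.le_of_diag_ne_zero M (abs_pos.mp hm0)
  have h2 := h.stable (M 0 1 / M 0 0)
  rw [← Real.log_abs, abs_of_nonneg (Real.log_nonneg hα)] at h1
  rw [abs_div] at h2
  have hq1 : √2 < 3 / 2 := by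
    rw [Real.sqrt_lt' (by norm_num)]
    norm_num
  obtain ⟨y, hy1, hy⟩ : ∃ y : ℝ, 1 ≤ y ∧ y ^ 2 = |M 0 0| :=
    ⟨√|M 0 0|, by rwa [Real.one_le_sqrt], Real.sq_sqrt hm0.le⟩
  have hy0 : 0 < y := by linarith
  rw [← hy] at h1 h2 hα' hm0
  have hlog : Real.log (y ^ 2) ≤ y - y⁻¹ := by
    have := Real.self_le_sinh_iff.mpr (Real.log_nonneg hy1)
    rw [Real.sinh_log hy0] at this
    rw [Real.log_pow]
    push_cast
    linarith
  have hlog0 : 0 ≤ Real.log (y ^ 2) := Real.log_nonneg (by nlinarith)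
  have key : 3 / 2 * (y ^ 2 - 1) * y ≤ ε * (y ^ 2 - 9 / 10) := by
    have hx0 : 0 ≤ y ^ 2 - 1 := by nlinarith
    refine abs_le_of_sq_le_sq' ?_ (mul_nonneg hε.le (by linarith)) |>.2
    have e : 25 / 2 * (y ^ 2 - 1) * (y ^ 2 - 9 / 10) ^ 2 ≤ ε ^ 2 * (y ^ 2 - 9 / 10) ^ 2 :=
      mul_le_mul_of_nonneg_right (by linarith) (sq_nonneg _)
    have e' : (3 / 2 * (y ^ 2 - 1) * y) ^ 2 ≤ 25 / 2 * (y ^ 2 - 1) * (y ^ 2 - 9 / 10) ^ 2 := by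
      generalize hX : y ^ 2 - 1 = x at hx0 ⊢
      have hyx : y ^ 2 = 1 + x := by linarith
      rw [mul_pow, hyx]
      nlinarith [mul_nonneg hx0 hx0, mul_nonneg hx0 (mul_nonneg hx0 hx0)]
    rw [mul_pow ε]
    exact e'.trans e
  have h3 : |M 1 0| / y ^ 2 + |M 0 1| / y ^ 2 < 9 / 10 * ε / y ^ 2 := by
    rw [← add_div]
    exact div_lt_div_of_pos_right (by linarith) hm0
  have h4 : 9 / 10 * ε / y ^ 2 + 3 / 2 * (y - y⁻¹) ≤ ε := by
    have : 9 / 10 * ε / y ^ 2 + 3 / 2 * (y - y⁻¹) =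
        (9 / 10 * ε + 3 / 2 * (y ^ 2 - 1) * y) / y ^ 2 := by
      field_simp
    rw [this, div_le_iff₀ hm0]
    linarith
  nlinarith

/-- For large `ε`, the upper right entry may be of size `ε ^ 3`. -/
lemma lt_of_one_le_of_large (h : IsLength N) (M : SL2) {ε : ℝ} (hε : 5 ≤ ε) (hα : 1 ≤ |M 0 0|)
    (hα' : |M 0 0| ≤ 1 + 2 / 25 * ε ^ 2) (hγ : |M 1 0| < 2 / 5 * ε)
    (hβ : |M 0 1| ≤ ε ^ 3 / 50) : N M < ε := by
  have hm0 : 0 < |M 0 0| := by linarith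
  have h1 := h.le_of_diag_ne_zero M (abs_pos.mp hm0)
  rw [← Real.log_abs, abs_of_nonneg (Real.log_nonneg hα)] at h1
  have hq0 : 0 < √2 := by positivity
  have h2 : |M 1 0| / |M 0 0| ≤ |M 1 0| := div_le_self (abs_nonneg _) hα
  have hdiv : |M 0 1 / M 0 0| = |M 0 1| / |M 0 0| := abs_div _ _
  rcases le_or_gt (√2 * |M 0 0|) (ε ^ 3 / 50) with hc | hc
  · have hb : 1 ≤ ε ^ 3 / (50 * √2) / |M 0 0| := by
      rw [le_div_iff₀ hm0, le_div_iff₀ (by positivity)]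
      linarith
    have h3 : N (Bmat (M 0 1 / M 0 0)) ≤ √2 * (1 + Real.log (ε ^ 3 / (50 * √2) / |M 0 0|)) := by
      refine h.upper_le_log ?_ hb
      rw [hdiv]
      refine (div_le_div_of_nonneg_right hβ hm0.le).trans (le_of_eq ?_)
      field_simp
    rw [Real.log_div (by positivity) hm0.ne'] at h3
    linarith [(h.upper_lt hε hβ).1]
  · have h3 : N (Bmat (M 0 1 / M 0 0)) ≤ √2 := by
      refine (h.stable _).trans ?_
      rw [hdiv, div_le_iff₀ hm0]
      linarith
    have hq1 : √2 < 14143 / 10000 := by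
      rw [Real.sqrt_lt' (by norm_num)]
      norm_num
    have hlog : Real.log |M 0 0| ≤ 2 / 5 * ε - 9 / 10 := by
      have e1 : |M 0 0| ≤ 3 * (ε / 5) ^ 2 := by nlinarith
      have e2 := Real.log_le_log hm0 e1
      have e3 := Real.log_le_sub_one_of_pos (show 0 < ε / 5 by linarith)
      have e4 : Real.log 3 < 11 / 10 := by
        have := Real.log_three_lt_d9
        linarith
      rw [Real.log_mul (by norm_num) (by positivity), Real.log_pow] at e2
      push_cast at e2
      linarith
    nlinarith [Real.log_nonneg hα]

lemma relPos_le (h : IsLength N) {r : ℝ} (hr : 0 < r) (w s₁ s₂ : ℝ) :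
    N (relPos r w s₁ s₂) ≤ (|s₁| + |s₂|) * r + |w| / r := by
  have h1 := h.mul₃ (Bmat (-s₂ * r)) (Cmat (w / r)) (Bmat (s₁ * r))
  have h2 := h.stable (-s₂ * r)
  have h3 := h.stable (s₁ * r)
  have h4 := h.unstable (w / r)
  rw [abs_mul, abs_of_pos hr] at h2 h3
  rw [abs_div, abs_of_pos hr] at h4
  rw [abs_neg] at h2
  rw [relPos]
  linarith

/-- The backward estimate under the shadowing condition on the stable coordinates. -/
lemma relPos_lt (h : IsLength N) {ε r w s₁ s₂ : ℝ} (hε : 0 < ε) (hr : 1 ≤ r)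
    (hs₁ : |s₁| < ε / 5) (hs₂ : |s₂| < ε / 5) (hw : |w| < 2 / 5 * ε)
    (hp : r * |s₁ - s₂ - s₁ * s₂ * w| < ε / 2) : N (relPos r w s₁ s₂) < ε := by
  have hr0 : 0 < r := by linarith
  obtain ⟨e00, e01, e10, e11⟩ := relPos_entries hr0.ne' w s₁ s₂
  obtain ⟨i00, i01, i10, -⟩ := SL2.inv_entries (relPos r w s₁ s₂)
  have hβ : |relPos r w s₁ s₂ 0 1| < ε / 2 := by rwa [e01, abs_mul, abs_of_pos hr0]
  have hγ : |relPos r w s₁ s₂ 1 0| < 2 / 5 * ε := by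
    rw [e10, abs_div, abs_of_pos hr0]
    exact (div_le_self (abs_nonneg _) hr).trans_lt hw
  have hw₁ := abs_le.mp (abs_mul_le_of_lt hs₁ hw)
  have hw₂ := abs_le.mp (abs_mul_le_of_lt hs₂ hw)
  rcases le_or_gt 1 |relPos r w s₁ s₂ 0 0| with h0 | h0
  · refine h.lt_of_one_le _ hε h0 ?_ (by linarith)
    rw [e00, abs_le]
    constructor <;> linarith
  rcases le_or_gt 1 |relPos r w s₁ s₂ 1 1| with h1 | h1
  · rw [← h.inv]
    refine h.lt_of_one_le _ hε (by rwa [i00]) ?_ (by rw [i01, i10, abs_neg, abs_neg]; linarith)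
    rw [i00, e11, abs_le]
    constructor <;> linarith
  rcases lt_or_ge (93 / 10) (ε ^ 2) with hε2 | hε2
  · exact h.lt_of_diag_le_one _ hε2 hε h0.le h1.le (by linarith) (Or.inl hβ)
  refine (h.relPos_le hr0 w s₁ s₂).trans_lt (add_mul_add_div_lt hε hε2 hr (abs_nonneg _)
    (abs_nonneg _) hs₁ hs₂ (abs_nonneg _) hw (lt_of_le_of_lt ?_ hp))
  refine mul_le_mul_of_nonneg_left ?_ hr0.le
  rw [e00, abs_lt] at h0
  rw [e11, abs_lt] at h1
  rcases lt_trichotomy w 0 with hw0 | rfl | hw0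
  · have a1 : 0 < s₁ := by nlinarith
    have a2 : s₂ < 0 := by nlinarith
    rw [abs_of_pos a1, abs_of_neg a2, abs_of_neg hw0]
    refine le_trans (le_of_eq ?_) (le_abs_self _)
    ring
  · simp at h0
  · have a1 : s₁ < 0 := by nlinarith
    have a2 : 0 < s₂ := by nlinarith
    rw [abs_of_neg a1, abs_of_pos a2, abs_of_pos hw0]
    refine le_trans (le_of_eq ?_) (neg_le_abs _)
    ring

/-- The backward estimate when both coordinates are close. -/
lemma relPos_lt_of_add (h : IsLength N) {ε r w s₁ s₂ : ℝ} (hε : 0 < ε) (hr : 1 ≤ r)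
    (hs₁ : |s₁| < ε / 5) (hs₂ : |s₂| < ε / 5) (hw : |w| < 2 / 5 * ε)
    (hp : r * (|w| + |s₁ - s₂|) < ε / 2) : N (relPos r w s₁ s₂) < ε := by
  have hr0 : 0 < r := by linarith
  have hss : |s₁ * s₂| ≤ ε ^ 2 / 25 := by
    rw [abs_mul]
    nlinarith [mul_le_mul hs₁.le hs₂.le (abs_nonneg _) (by linarith)]
  have hsub : |s₁ - s₂ - s₁ * s₂ * w| ≤ |s₁ - s₂| + |s₁ * s₂| * |w| := by
    rw [← abs_mul (s₁ * s₂)]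
    exact abs_sub _ _
  have hssw := mul_le_mul_of_nonneg_right hss (abs_nonneg w)
  rcases le_or_gt ε 5 with hε5 | hε5
  · refine h.relPos_lt hε hr hs₁ hs₂ hw (lt_of_le_of_lt ?_ hp)
    refine mul_le_mul_of_nonneg_left ?_ hr0.le
    have : ε ^ 2 / 25 * |w| ≤ |w| := mul_le_of_le_one_left (abs_nonneg w) (by nlinarith)
    linarith
  obtain ⟨e00, e01, e10, e11⟩ := relPos_entries hr0.ne' w s₁ s₂
  obtain ⟨i00, i01, i10, -⟩ := SL2.inv_entries (relPos r w s₁ s₂)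
  have hβ : |relPos r w s₁ s₂ 0 1| ≤ ε ^ 3 / 50 := by
    rw [e01, abs_mul, abs_of_pos hr0]
    have h1 : |s₁ - s₂ - s₁ * s₂ * w| ≤ ε ^ 2 / 25 * (|w| + |s₁ - s₂|) := by
      have : |s₁ - s₂| ≤ ε ^ 2 / 25 * |s₁ - s₂| :=
        le_mul_of_one_le_left (abs_nonneg _) (by nlinarith)
      linarith
    have h2 := mul_le_mul_of_nonneg_left h1 hr0.le
    have h3 := mul_le_mul_of_nonneg_left hp.le (show 0 ≤ ε ^ 2 / 25 by positivity)
    nlinarith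
  have hγ : |relPos r w s₁ s₂ 1 0| < 2 / 5 * ε := by
    rw [e10, abs_div, abs_of_pos hr0]
    exact (div_le_self (abs_nonneg _) hr).trans_lt hw
  have hw₁ := abs_le.mp (abs_mul_le_of_lt hs₁ hw)
  have hw₂ := abs_le.mp (abs_mul_le_of_lt hs₂ hw)
  rcases le_or_gt 1 |relPos r w s₁ s₂ 0 0| with h0 | h0
  · refine h.lt_of_one_le_of_large _ hε5.le h0 ?_ hγ hβ
    rw [e00, abs_le]
    constructor <;> linarith
  rcases le_or_gt 1 |relPos r w s₁ s₂ 1 1| with h1 | h1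
  · rw [← h.inv]
    refine h.lt_of_one_le_of_large _ hε5.le (by rwa [i00]) ?_ (by rwa [i10, abs_neg])
      (by rwa [i01, abs_neg])
    rw [i00, e11, abs_le]
    constructor <;> linarith
  exact h.lt_of_diag_le_one _ (by nlinarith) hε h0.le h1.le (by linarith)
    (Or.inr ⟨hε5.le, (h.upper_lt hε5.le hβ).2⟩)

end IsLength

lemma isLength_of_leftInvariant {dG : PSL2 → PSL2 → ℝ}
    (hdG_symm : ∀ g h : PSL2, dG g h = dG h g)
    (hdG_tri : ∀ g h k : PSL2, dG g k ≤ dG g h + dG h k)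
    (hdG_left : ∀ k g h : PSL2, dG (k * g) (k * h) = dG g h)
    (hdG_b : ∀ s : ℝ, dG (bhor s) 1 ≤ |s|)
    (hdG_c : ∀ u : ℝ, dG (chor u) 1 ≤ |u|)
    (hdG_a : ∀ τ : ℝ, dG (aflow τ) 1 ≤ |τ| / √2) :
    IsLength fun M => dG (projSL M) 1 where
  mul X Y := by
    have h1 := hdG_tri (projSL X * projSL Y) (projSL X) 1
    have h2 := hdG_left (projSL X) (projSL Y) 1
    rw [mul_one] at h2
    simp only [map_mul]
    linarith
  neg X := by simp only [projSL_neg]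
  inv X := by
    have := hdG_left (projSL X) (projSL X)⁻¹ 1
    rw [mul_inv_cancel, mul_one] at this
    simp only [map_inv]
    rw [← this, hdG_symm]
  stable := hdG_b
  unstable := hdG_c
  diag := hdG_a

lemma SL2.mul_relPos (t u₁ u₂ s₁ s₂ : ℝ) :
    Cmat u₂ * Bmat s₂ * Amat t * relPos (Real.exp (-t)) (u₁ - u₂) s₁ s₂ =
      Cmat u₁ * Bmat s₁ * Amat t := by
  have he : Real.exp (-t) = ((Real.exp (t / 2))⁻¹) ^ 2 := by
    rw [← Real.exp_neg, ← Real.exp_nat_mul]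
    congr 1
    push_cast
    ring
  have hp := Real.exp_pos (t / 2)
  rw [he]
  refine SL2.ext_entries ?_ ?_ ?_ ?_ <;> simp only [relPos, SL2.mul_apply] <;>
    simp [Amat, Bmat, Cmat, Real.exp_neg] <;> field_simp <;> ring

lemma dX_flow_le {dG : PSL2 → PSL2 → ℝ} (hdG_self : ∀ g : PSL2, dG g g = 0)
    (hdG_symm : ∀ g h : PSL2, dG g h = dG h g)
    (hdG_tri : ∀ g h k : PSL2, dG g k ≤ dG g h + dG h k)
    (hdG_left : ∀ k g h : PSL2, dG (k * g) (k * h) = dG g h)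
    (Γ : Subgroup PSL2) (g : PSL2) (t u₁ u₂ s₁ s₂ : ℝ) :
    dX Γ dG (flow Γ t (xmk Γ (g * chor u₁ * bhor s₁))) (flow Γ t (xmk Γ (g * chor u₂ * bhor s₂))) ≤
      dG (projSL (relPos (Real.exp (-t)) (u₁ - u₂) s₁ s₂)) 1 := by
  have hnonneg : ∀ a b, 0 ≤ dG a b := fun a b => by
    linarith [hdG_tri a b a, hdG_self a, hdG_symm a b]
  refine csInf_le ⟨0, ?_⟩ ⟨g * chor u₁ * bhor s₁ * aflow t, g * chor u₂ * bhor s₂ * aflow t,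
    rfl, rfl, ?_⟩
  · rintro _ ⟨a, b, -, -, rfl⟩
    exact hnonneg a b
  · have h1 := congrArg projSL (SL2.mul_relPos t u₁ u₂ s₁ s₂)
    simp only [map_mul] at h1
    have h2 := hdG_left (g * chor u₂ * bhor s₂ * aflow t)
      (projSL (relPos (Real.exp (-t)) (u₁ - u₂) s₁ s₂)) 1
    rw [mul_one] at h2
    rw [← h2]
    simp only [chor, bhor, aflow, mul_assoc] at h1 ⊢
    rw [h1]

theorem stmt_3
    (dG : PSL2 → PSL2 → ℝ)
    (hdG_self : ∀ g : PSL2, dG g g = 0)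
    (hdG_sep : ∀ g h : PSL2, dG g h = 0 → g = h)
    (hdG_symm : ∀ g h : PSL2, dG g h = dG h g)
    (hdG_tri : ∀ g h k : PSL2, dG g k ≤ dG g h + dG h k)
    (hdG_left : ∀ k g h : PSL2, dG (k * g) (k * h) = dG g h)
    (hdG_b : ∀ s : ℝ, dG (bhor s) 1 ≤ |s|)
    (hdG_c : ∀ u : ℝ, dG (chor u) 1 ≤ |u|)
    (hdG_a : ∀ τ : ℝ, dG (aflow τ) 1 ≤ |τ| / Real.sqrt 2)
    (Γ : Subgroup PSL2) (σ₀ : ℝ) (hσ₀ : 0 < σ₀)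
    (hΓ : ∀ (g γ : PSL2), γ ∈ Γ → γ ≠ 1 → σ₀ ≤ dG g (γ * g))
    (ε : ℝ) (hε0 : 0 < ε) (hε : ε < σ₀ / 4)
    (g : PSL2) (u₁ s₁ u₂ s₂ : ℝ)
    (hu₁ : |u₁| < ε / 5) (hs₁ : |s₁| < ε / 5) (hu₂ : |u₂| < ε / 5) (hs₂ : |s₂| < ε / 5) :
    ∀ T : ℝ, 0 < T →
      ((|u₁ - u₂| < ε / 2 * Real.exp (-T) →
        ∀ t ∈ Set.Icc (0:ℝ) T,
          dX Γ dG (flow Γ t (xmk Γ (g * chor u₁ * bhor s₁)))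
            (flow Γ t (xmk Γ (g * chor u₂ * bhor s₂))) < ε) ∧
      (|s₁ - s₂ - s₁ * s₂ * (u₁ - u₂)| < ε / 2 * Real.exp (-T) →
        ∀ t ∈ Set.Icc (-T) (0:ℝ),
          dX Γ dG (flow Γ t (xmk Γ (g * chor u₁ * bhor s₁)))
            (flow Γ t (xmk Γ (g * chor u₂ * bhor s₂))) < ε) ∧
      (|u₁ - u₂| + |s₁ - s₂| < ε / 2 * Real.exp (-T) →
        ∀ t ∈ Set.Icc (-T) T,
          dX Γ dG (flow Γ t (xmk Γ (g * chor u₁ * bhor s₁)))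
            (flow Γ t (xmk Γ (g * chor u₂ * bhor s₂))) < ε)) := by
  intro T hT
  have hN := isLength_of_leftInvariant hdG_symm hdG_tri hdG_left hdG_b hdG_c hdG_a
  have hle := dX_flow_le hdG_self hdG_symm hdG_tri hdG_left Γ g
  have hw : |u₁ - u₂| < 2 / 5 * ε := (abs_sub _ _).trans_lt (by linarith)
  have hscale : ∀ {p τ : ℝ}, 0 ≤ p → p < ε / 2 * Real.exp (-T) → τ ≤ T →
      Real.exp τ * p < ε / 2 := by
    intro p τ hp0 hp hτ
    have h1 : Real.exp τ * p ≤ Real.exp T * p :=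
      mul_le_mul_of_nonneg_right (Real.exp_le_exp.mpr hτ) hp0
    have h2 := mul_lt_mul_of_pos_left hp (Real.exp_pos T)
    have h3 : Real.exp T * (ε / 2 * Real.exp (-T)) = ε / 2 := by
      rw [mul_left_comm, ← Real.exp_add, add_neg_cancel, Real.exp_zero, mul_one]
    linarith
  have forward : |u₁ - u₂| < ε / 2 * Real.exp (-T) → ∀ t ∈ Set.Icc (0:ℝ) T,
      dX Γ dG (flow Γ t (xmk Γ (g * chor u₁ * bhor s₁)))
        (flow Γ t (xmk Γ (g * chor u₂ * bhor s₂))) < ε := by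
    intro hu t ht
    refine (hle t u₁ u₂ s₁ s₂).trans_lt ((hN.relPos_le (Real.exp_pos (-t)) _ s₁ s₂).trans_lt ?_)
    have h1 := hscale (abs_nonneg _) hu ht.2
    have h2 : (|s₁| + |s₂|) * Real.exp (-t) ≤ |s₁| + |s₂| :=
      mul_le_of_le_one_right (by positivity) (Real.exp_le_one_iff.mpr (by linarith [ht.1]))
    rw [Real.exp_neg, div_inv_eq_mul, mul_comm |u₁ - u₂|, ← Real.exp_neg]
    linarith
  refine ⟨forward, fun hs t ht => ?_, fun hus t ht => ?_⟩
  · exact (hle t u₁ u₂ s₁ s₂).trans_lt (hN.relPos_lt hε0 (Real.one_le_exp (by linarith [ht.2]))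
      hs₁ hs₂ hw (hscale (abs_nonneg _) hs (by linarith [ht.1])))
  · rcases le_total 0 t with h0 | h0
    · exact forward (by linarith [abs_nonneg (s₁ - s₂)]) t ⟨h0, ht.2⟩
    · exact (hle t u₁ u₂ s₁ s₂).trans_lt (hN.relPos_lt_of_add hε0 (Real.one_le_exp (by linarith))
        hs₁ hs₂ hw (hscale (by positivity) hus (by linarith [ht.1])))
end
end

section
/- There exists ε* > 0 with the following property: if ε ∈ (0, ε*) and x₁, x₂ ∈ X are periodic points of (φ_t) with periods T₁, T₂ > 0 such that |T₁ − T₂| ≤ √2 ε and d_X(φ_t(x₁), φ_t(x₂)) < ε for all t ∈ [0, min{T₁, T₂}], then the orbits of x₁ and x₂ under (φ_t) are identical. -/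
noncomputable section

open Real

theorem xmk_eq_iff (Γ : Subgroup PSL2) (g h : PSL2) : xmk Γ g = xmk Γ h ↔ h * g⁻¹ ∈ Γ :=
  Quotient.eq.trans QuotientGroup.rightRel_apply

theorem xmk_mul_left (Γ : Subgroup PSL2) {γ : PSL2} (hγ : γ ∈ Γ) (g : PSL2) :
    xmk Γ (γ * g) = xmk Γ g := by
  rw [eq_comm, xmk_eq_iff]
  simpa using hγ

theorem SL2_mul_apply (M N : SL2) (i j : Fin 2) :
    (M * N) i j = M i 0 * N 0 j + M i 1 * N 1 j := by
  change (M.1 * N.1) i j = _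
  rw [Matrix.mul_apply, Fin.sum_univ_two]

theorem Amat_add (s t : ℝ) : Amat (s + t) = Amat s * Amat t := by
  refine Matrix.SpecialLinearGroup.ext _ _ fun i j => ?_
  rw [SL2_mul_apply]
  fin_cases i <;> fin_cases j <;> simp [Amat, ← Real.exp_add] <;> ring

theorem aflow_add (s t : ℝ) : aflow (s + t) = aflow s * aflow t := by
  unfold aflow
  rw [Amat_add, map_mul]

theorem aflow_zero : aflow 0 = 1 := by
  have h := aflow_add 0 0
  simpa using h

theorem projSL_eq_iff (M N : SL2) :
    projSL M = projSL N ↔ ∃ r : ℝ, r ^ 2 = 1 ∧ ∀ i j, N i j = r * M i j := by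
  change (M : PSL2) = (N : PSL2) ↔ _
  rw [QuotientGroup.eq, Matrix.SpecialLinearGroup.mem_center_iff]
  refine exists_congr fun r => and_congr (by simp) ?_
  constructor
  · intro h i j
    have hN : N = M * (M⁻¹ * N) := by group
    rw [hN, Matrix.SpecialLinearGroup.coe_mul, ← h]
    simp [mul_comm]
  · intro h
    have hN : (N : Matrix (Fin 2) (Fin 2) ℝ) = r • (M : Matrix (Fin 2) (Fin 2) ℝ) := by
      ext i j
      simpa using h i j
    have hM : ((M⁻¹ * M : SL2) : Matrix (Fin 2) (Fin 2) ℝ) = 1 := by simp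
    rw [Matrix.SpecialLinearGroup.coe_mul] at hM ⊢
    rw [hN, Matrix.mul_smul, hM, Matrix.smul_one_eq_diagonal]
    rfl

/-- An element intertwining two geodesic translations of positive length is itself one. -/
theorem exists_eq_aflow_of_aflow_mul_eq {g : PSL2} {T₁ T₂ : ℝ} (h₁ : 0 < T₁) (h₂ : 0 < T₂)
    (h : aflow T₁ * g = g * aflow T₂) : ∃ τ : ℝ, g = aflow τ := by
  obtain ⟨M, rfl⟩ : ∃ M, projSL M = g := QuotientGroup.mk'_surjective _ g
  unfold aflow at h
  rw [← map_mul, ← map_mul, projSL_eq_iff] at h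
  obtain ⟨r, hr, h⟩ := h
  have h01 : (M * Amat T₂) 0 1 = r * (Amat T₁ * M) 0 1 := h 0 1
  have h10 : (M * Amat T₂) 1 0 = r * (Amat T₁ * M) 1 0 := h 1 0
  rw [SL2_mul_apply, SL2_mul_apply] at h01 h10
  simp [Amat] at h01 h10
  have hE₁ : 1 < Real.exp (T₁ / 2) := Real.one_lt_exp_iff.2 (by linarith)
  have hE₂ : 1 < Real.exp (T₂ / 2) := Real.one_lt_exp_iff.2 (by linarith)
  have hF₁ : Real.exp (-(T₁ / 2)) < 1 := Real.exp_lt_one_iff.2 (by linarith)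
  have hF₂ : Real.exp (-(T₂ / 2)) < 1 := Real.exp_lt_one_iff.2 (by linarith)
  have hr' : r = 1 ∨ r = -1 := sq_eq_one_iff.1 hr
  have hF₁' := Real.exp_pos (-(T₁ / 2))
  have hF₂' := Real.exp_pos (-(T₂ / 2))
  have hq : M 0 1 = 0 := by
    have : M 0 1 * (Real.exp (-(T₂ / 2)) - r * Real.exp (T₁ / 2)) = 0 := by linarith
    refine (mul_eq_zero.1 this).resolve_right ?_
    rcases hr' with rfl | rfl
    · exact ne_of_lt (by linarith)
    · exact ne_of_gt (by linarith)
  have hs : M 1 0 = 0 := by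
    have : M 1 0 * (Real.exp (T₂ / 2) - r * Real.exp (-(T₁ / 2))) = 0 := by linarith
    refine (mul_eq_zero.1 this).resolve_right ?_
    rcases hr' with rfl | rfl <;> exact ne_of_gt (by linarith)
  have hdet : M 0 0 * M 1 1 = 1 := by
    have := M.det_coe
    rw [Matrix.det_fin_two] at this
    simpa [hq] using this
  have hp : M 0 0 ≠ 0 := left_ne_zero_of_mul_eq_one hdet
  have hM : M 1 1 = (M 0 0)⁻¹ := eq_inv_of_mul_eq_one_right hdet
  have hexp := Real.exp_log_eq_abs hp
  refine ⟨2 * Real.log (M 0 0), ?_⟩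
  unfold aflow
  rw [projSL_eq_iff]
  rcases abs_choice (M 0 0) with ha | ha
  · refine ⟨1, by norm_num, fun i j => ?_⟩
    fin_cases i <;> fin_cases j <;> simp [Amat, hq, hs, hM, Real.exp_neg, hexp, ha]
  · refine ⟨-1, by norm_num, fun i j => ?_⟩
    fin_cases i <;> fin_cases j <;> simp [Amat, hq, hs, hM, Real.exp_neg, hexp, ha]

theorem exists_lift_lt_of_dX_lt {Γ : Subgroup PSL2} {dG : PSL2 → PSL2 → ℝ}
    (hdG_left : ∀ k g h : PSL2, dG (k * g) (k * h) = dG g h) {g h : PSL2} {ε : ℝ}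
    (hd : dX Γ dG (xmk Γ g) (xmk Γ h) < ε) : ∃ γ ∈ Γ, dG g (γ * h) < ε := by
  obtain ⟨_, ⟨g', h', hg, hh, rfl⟩, hlt⟩ :=
    exists_lt_of_csInf_lt (by exact ⟨_, g, h, rfl, rfl, rfl⟩) hd
  rw [xmk_eq_iff] at hg hh
  refine ⟨g * g'⁻¹ * (h * h'⁻¹)⁻¹, Γ.mul_mem hg (Γ.inv_mem hh), ?_⟩
  rw [← hdG_left (g * g'⁻¹)] at hlt
  have e₁ : g * g'⁻¹ * g' = g := by group
  have e₂ : g * g'⁻¹ * h' = g * g'⁻¹ * (h * h'⁻¹)⁻¹ * h := by group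
  rwa [e₁, e₂] at hlt

theorem range_flow_mul_aflow (Γ : Subgroup PSL2) (g : PSL2) (τ : ℝ) :
    Set.range (fun t : ℝ => flow Γ t (xmk Γ (g * aflow τ))) =
      Set.range (fun t : ℝ => flow Γ t (xmk Γ g)) := by
  have h : (fun t : ℝ => flow Γ t (xmk Γ (g * aflow τ))) =
      (fun t : ℝ => flow Γ t (xmk Γ g)) ∘ Equiv.addLeft τ := by
    funext t
    change xmk Γ (g * aflow τ * aflow t) = xmk Γ (g * aflow (τ + t))
    rw [aflow_add, mul_assoc]
  rw [h, (Equiv.addLeft τ).surjective.range_comp]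

theorem stmt_13
    (dG : PSL2 → PSL2 → ℝ)
    (hdG_self : ∀ g : PSL2, dG g g = 0)
    (hdG_sep : ∀ g h : PSL2, dG g h = 0 → g = h)
    (hdG_symm : ∀ g h : PSL2, dG g h = dG h g)
    (hdG_tri : ∀ g h k : PSL2, dG g k ≤ dG g h + dG h k)
    (hdG_left : ∀ k g h : PSL2, dG (k * g) (k * h) = dG g h)
    (hdG_b : ∀ s : ℝ, dG (bhor s) 1 ≤ |s|)
    (hdG_c : ∀ u : ℝ, dG (chor u) 1 ≤ |u|)
    (hdG_a : ∀ τ : ℝ, dG (aflow τ) 1 ≤ |τ| / Real.sqrt 2)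
    (Γ : Subgroup PSL2) (σ₀ : ℝ) (hσ₀ : 0 < σ₀)
    (hΓ : ∀ (g γ : PSL2), γ ∈ Γ → γ ≠ 1 → σ₀ ≤ dG g (γ * g))
    (hcomp : CompactSpace (Xq Γ)) :
    ∃ εstar : ℝ, 0 < εstar ∧
      ∀ ε : ℝ, 0 < ε → ε < εstar →
        ∀ (x₁ x₂ : Xq Γ) (T₁ T₂ : ℝ), 0 < T₁ → 0 < T₂ →
          flow Γ T₁ x₁ = x₁ → flow Γ T₂ x₂ = x₂ →
          |T₁ - T₂| ≤ Real.sqrt 2 * ε →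
          (∀ t ∈ Set.Icc (0:ℝ) (min T₁ T₂), dX Γ dG (flow Γ t x₁) (flow Γ t x₂) < ε) →
          Set.range (fun t : ℝ => flow Γ t x₁) = Set.range (fun t : ℝ => flow Γ t x₂) := by
  have hflow' : ∀ (g : PSL2) (s t : ℝ),
      dG (g * aflow s) (g * aflow t) ≤ |s - t| / Real.sqrt 2 := by
    intro g s t
    have hs : g * aflow s = g * aflow t * aflow (s - t) := by
      rw [mul_assoc, ← aflow_add, add_sub_cancel]
    have h1 := hdG_left (g * aflow t) (aflow (s - t)) 1
    rw [← hs, mul_one] at h1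
    rw [h1]
    exact hdG_a _
  have hflow : ∀ (g : PSL2) (s t : ℝ), dG (g * aflow s) (g * aflow t) ≤ |s - t| := by
    intro g s t
    exact (hflow' g s t).trans (div_le_self (abs_nonneg _) (Real.one_le_sqrt.2 one_le_two))
  have hinj : ∀ (g γ : PSL2), γ ∈ Γ → dG g (γ * g) < σ₀ → γ = 1 := by
    intro g γ hγ hlt
    by_contra hne
    exact absurd (hΓ g γ hγ hne) (not_le.2 hlt)
  refine ⟨σ₀ / 4, by positivity, ?_⟩
  intro ε hε hεσ x₁ x₂ T₁ T₂ hT₁ hT₂ hper₁ hper₂ hT hclose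
  obtain ⟨g₁, rfl⟩ : ∃ g, xmk Γ g = x₁ := Quotient.exists_rep x₁
  obtain ⟨g₂, rfl, h0⟩ : ∃ g, xmk Γ g = x₂ ∧ dG g₁ g < ε := by
    obtain ⟨g, rfl⟩ : ∃ g, xmk Γ g = x₂ := Quotient.exists_rep x₂
    have h := hclose 0 ⟨le_rfl, (lt_min hT₁ hT₂).le⟩
    change dX Γ dG (xmk Γ (g₁ * aflow 0)) (xmk Γ (g * aflow 0)) < ε at h
    rw [aflow_zero, mul_one, mul_one] at h
    obtain ⟨γ, hγ, hlt⟩ := exists_lift_lt_of_dX_lt hdG_left h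
    exact ⟨γ * g, xmk_mul_left Γ hγ g, hlt⟩
  set m := min T₁ T₂ with hm
  have hm0 : 0 ≤ m := (lt_min hT₁ hT₂).le
  have hstep : ∀ s t : ℝ, t ∈ Set.Icc 0 m → |t - s| ≤ σ₀ / 4 →
      dG (g₁ * aflow s) (g₂ * aflow s) < ε → dG (g₁ * aflow t) (g₂ * aflow t) < ε := by
    intro s t ht hst hs
    obtain ⟨γ, hγ, hlt⟩ := exists_lift_lt_of_dX_lt hdG_left (hclose t ht)
    have hγ1 : γ = 1 := by
      refine hinj (g₂ * aflow t) γ hγ ?_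
      have e1 := hdG_tri (g₂ * aflow t) (g₂ * aflow s) (γ * (g₂ * aflow t))
      have e2 := hdG_tri (g₂ * aflow s) (g₁ * aflow s) (γ * (g₂ * aflow t))
      have e3 := hdG_tri (g₁ * aflow s) (g₁ * aflow t) (γ * (g₂ * aflow t))
      have e4 := hdG_symm (g₂ * aflow s) (g₁ * aflow s)
      have e5 := hflow g₂ t s
      have e6 := hflow g₁ s t
      rw [abs_sub_comm] at e6
      linarith
    simpa [hγ1] using hlt
  have hall : ∀ n : ℕ, ∀ t ∈ Set.Icc 0 m, t ≤ n * (σ₀ / 4) →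
      dG (g₁ * aflow t) (g₂ * aflow t) < ε := by
    intro n
    induction n with
    | zero =>
      intro t ht htn
      have : t = 0 := le_antisymm (by simpa using htn) ht.1
      simpa [this, aflow_zero] using h0
    | succ n ih =>
      intro t ht htn
      push_cast at htn
      by_cases hle : t ≤ σ₀ / 4
      · refine hstep 0 t ht ?_ (by simpa [aflow_zero] using h0)
        rwa [sub_zero, abs_of_nonneg ht.1]
      · refine hstep (t - σ₀ / 4) t ht ?_ (ih _ ⟨by linarith, by linarith [ht.2]⟩ (by linarith))
        rw [sub_sub_cancel, abs_of_pos (by positivity)]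
  have hend : dG (g₁ * aflow m) (g₂ * aflow m) < ε := by
    obtain ⟨n, hn⟩ := exists_nat_ge (m / (σ₀ / 4))
    exact hall n m ⟨hm0, le_rfl⟩ ((div_le_iff₀ (by positivity)).1 hn)
  have hγ₁ : g₁ * aflow T₁ * g₁⁻¹ ∈ Γ := (xmk_eq_iff Γ _ _).1 hper₁.symm
  have hγ₂ : g₂ * aflow T₂ * g₂⁻¹ ∈ Γ := (xmk_eq_iff Γ _ _).1 hper₂.symm
  have hends : dG (g₁ * aflow T₁) (g₂ * aflow T₂) < ε + ε := by
    have e1 := hdG_tri (g₁ * aflow T₁) (g₁ * aflow m) (g₂ * aflow T₂)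
    have e2 := hdG_tri (g₁ * aflow m) (g₂ * aflow m) (g₂ * aflow T₂)
    have e3 := hflow' g₁ T₁ m
    have e4 := hflow' g₂ m T₂
    have hsum : |T₁ - m| / Real.sqrt 2 + |m - T₂| / Real.sqrt 2 ≤ ε := by
      rw [← add_div, div_le_iff₀ (by positivity), mul_comm ε]
      refine le_trans (le_of_eq ?_) hT
      rcases le_total T₁ T₂ with h | h <;> simp [hm, h]
    linarith
  have heq : (g₁ * aflow T₁ * g₁⁻¹)⁻¹ * (g₂ * aflow T₂ * g₂⁻¹) = 1 := by
    refine hinj g₂ _ (Γ.mul_mem (Γ.inv_mem hγ₁) hγ₂) ?_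
    rw [← hdG_left (g₁ * aflow T₁ * g₁⁻¹)]
    have e1 : g₁ * aflow T₁ * g₁⁻¹ *
        ((g₁ * aflow T₁ * g₁⁻¹)⁻¹ * (g₂ * aflow T₂ * g₂⁻¹) * g₂) = g₂ * aflow T₂ := by group
    rw [e1]
    have e2 := hdG_tri (g₁ * aflow T₁ * g₁⁻¹ * g₂) (g₁ * aflow T₁) (g₂ * aflow T₂)
    have e3 := hdG_left (g₁ * aflow T₁ * g₁⁻¹) g₂ g₁
    rw [inv_mul_cancel_right, hdG_symm g₂ g₁] at e3
    linarith
  have hcomm : aflow T₁ * (g₁⁻¹ * g₂) = g₁⁻¹ * g₂ * aflow T₂ := by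
    rw [inv_mul_eq_one] at heq
    calc aflow T₁ * (g₁⁻¹ * g₂) = g₁⁻¹ * (g₁ * aflow T₁ * g₁⁻¹) * g₂ := by group
      _ = g₁⁻¹ * g₂ * aflow T₂ := by rw [heq]; group
  obtain ⟨τ, hτ⟩ := exists_eq_aflow_of_aflow_mul_eq hT₁ hT₂ hcomm
  rw [← mul_inv_cancel_left g₁ g₂, hτ, range_flow_mul_aflow]
end
end
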